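/- arXiv:2209.13550 — 2 statements merged into one kernel-verified Lean document; each statement's English description precedes it below -/
import Mathlib

section
/- Let k ∈ ℝ, let z ∈ ℝ³, and let x ∈ ℝ³ with x ≠ z. Write r = ‖x − z‖ and r̂ = (x − z)/r. Then the Hessian in x of G_k(x,z) (the 3×3 complex matrix of second partial derivatives (D_x² G_k)_{ij} = ∂²G_k/∂x_i∂x_j) exists and equals D_x² G_k(x,z) = (e^{i k r}/(4π)) [ (1/r³)(3 r̂ ⊗ r̂ − I) − (i k / r²)(3 r̂ ⊗ r̂ − I) − (k²/r) r̂ ⊗ r̂ ], where (r̂ ⊗ r̂)_{ij} = r̂_i r̂_j and I is the 3×3 identity matrix. -/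
/-- The Helmholtz free-space Green's function
`G_k(x,z) = e^{i k ‖x − z‖} / (4π ‖x − z‖)`. -/
noncomputable def Gk (k : ℝ) (x z : EuclideanSpace ℝ (Fin 3)) : ℂ :=
  Complex.exp (Complex.I * k * ‖x - z‖) / (4 * Real.pi * ‖x - z‖)

/-- The unit vector `r̂ = (x − z)/‖x − z‖`, viewed in `ℂ³`. -/
noncomputable def rhat (x z : EuclideanSpace ℝ (Fin 3)) : Fin 3 → ℂ :=
  fun i => (((x - z) i / ‖x - z‖ : ℝ) : ℂ)

theorem hasFDerivAt_norm_sub {E : Type*} [NormedAddCommGroup E] [InnerProductSpace ℝ E]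
    {x z : E} (hxz : x ≠ z) :
    HasFDerivAt (fun w => ‖w - z‖) (‖x - z‖⁻¹ • innerSL ℝ (x - z)) x := by
  have hr : ‖x - z‖ ≠ 0 := norm_ne_zero_iff.mpr (sub_ne_zero.mpr hxz)
  have hsq := ((hasFDerivAt_id x).sub_const z).norm_sq.sqrt (by simpa using hr)
  simp only [id, Real.sqrt_sq (norm_nonneg _)] at hsq
  refine hsq.congr_fderiv ?_
  ext v
  simp
  field_simp

theorem hasFDerivAt_comp_norm_sub {E F : Type*} [NormedAddCommGroup E] [InnerProductSpace ℝ E]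
    [NormedAddCommGroup F] [NormedSpace ℝ F] {f : ℝ → F} {f' : F} {x z : E} (hxz : x ≠ z)
    (hf : HasDerivAt f f' ‖x - z‖) :
    HasFDerivAt (fun w => f ‖w - z‖)
      ((‖x - z‖⁻¹ • innerSL ℝ (x - z)).smulRight f') x :=
  (hf.hasFDerivAt.comp x (hasFDerivAt_norm_sub hxz)).congr_fderiv <| by
    ext v
    simp [mul_smul, sub_smul]

/-- The profile `g'(r) / r` of the gradient of the radial function `g(r) = e^{ikr} / (4πr)`. -/
noncomputable def gradientProfile (k r : ℝ) : ℂ :=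
  Complex.exp (Complex.I * k * r) / (4 * Real.pi) *
    (Complex.I * k / (r : ℂ) ^ 2 - 1 / (r : ℂ) ^ 3)

theorem hasDerivAt_exp_I_mul (k r : ℝ) :
    HasDerivAt (fun s : ℝ => Complex.exp (Complex.I * k * s))
      (Complex.exp (Complex.I * k * r) * (Complex.I * k)) r := by
  simpa using ((hasDerivAt_id r).ofReal_comp.const_mul (Complex.I * k)).cexp

theorem hasDerivAt_radialGreen (k : ℝ) {r : ℝ} (hr : r ≠ 0) :
    HasDerivAt (fun s : ℝ => Complex.exp (Complex.I * k * s) / (4 * Real.pi * s))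
      (r * gradientProfile k r) r := by
  have hid : HasDerivAt (fun s : ℝ => (s : ℂ)) 1 r := (hasDerivAt_id r).ofReal_comp
  refine ((hasDerivAt_exp_I_mul k r).div (hid.const_mul (4 * Real.pi : ℂ))
    (by simp [hr, Real.pi_ne_zero])).congr_deriv ?_
  simp only [gradientProfile]
  field_simp

theorem hasDerivAt_gradientProfile (k : ℝ) {r : ℝ} (hr : r ≠ 0) :
    HasDerivAt (gradientProfile k)
      (Complex.exp (Complex.I * k * r) / (4 * Real.pi) *
        (3 / (r : ℂ) ^ 4 - 3 * Complex.I * k / (r : ℂ) ^ 3 - (k : ℂ) ^ 2 / (r : ℂ) ^ 2)) r := by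
  have hr' : (r : ℂ) ≠ 0 := by exact_mod_cast hr
  have hid : HasDerivAt (fun s : ℝ => (s : ℂ)) 1 r := (hasDerivAt_id r).ofReal_comp
  refine (((hasDerivAt_exp_I_mul k r).div_const (4 * Real.pi : ℂ)).mul
    (((hasDerivAt_const r (Complex.I * k)).div (hid.pow 2) (pow_ne_zero 2 hr')).sub
      ((hasDerivAt_const r (1 : ℂ)).div (hid.pow 3) (pow_ne_zero 3 hr')))).congr_deriv ?_
  simp only [Pi.div_apply, Pi.sub_apply, Pi.pow_apply]
  field_simp
  ring_nf
  simp only [Complex.I_sq]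
  ring

theorem fderiv_Gk_single (k : ℝ) {x z : EuclideanSpace ℝ (Fin 3)} (hxz : x ≠ z) (j : Fin 3) :
    fderiv ℝ (fun w => Gk k w z) x (EuclideanSpace.single j 1) =
      ((x - z) j : ℝ) * gradientProfile k ‖x - z‖ := by
  have hr : ‖x - z‖ ≠ 0 := norm_ne_zero_iff.mpr (sub_ne_zero.mpr hxz)
  have hr' : (‖x - z‖ : ℂ) ≠ 0 := by exact_mod_cast hr
  have h : HasFDerivAt (fun w => Gk k w z) _ x :=
    hasFDerivAt_comp_norm_sub hxz (hasDerivAt_radialGreen k hr)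
  rw [h.fderiv]
  simp [EuclideanSpace.inner_single_right]
  field_simp

theorem hasFDerivAt_fderiv_Gk_single (k : ℝ) {x z : EuclideanSpace ℝ (Fin 3)} (hxz : x ≠ z)
    (j : Fin 3) :
    HasFDerivAt (fun y => fderiv ℝ (fun w => Gk k w z) y (EuclideanSpace.single j 1))
      ((x - z) j • (‖x - z‖⁻¹ • innerSL ℝ (x - z)).smulRight
          (Complex.exp (Complex.I * k * ‖x - z‖) / (4 * Real.pi) *
            (3 / (‖x - z‖ : ℂ) ^ 4 - 3 * Complex.I * k / (‖x - z‖ : ℂ) ^ 3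
              - (k : ℂ) ^ 2 / (‖x - z‖ : ℂ) ^ 2)) +
        (EuclideanSpace.proj (𝕜 := ℝ) j).smulRight (gradientProfile k ‖x - z‖)) x := by
  have hr : ‖x - z‖ ≠ 0 := norm_ne_zero_iff.mpr (sub_ne_zero.mpr hxz)
  have hcoord : HasFDerivAt (fun y : EuclideanSpace ℝ (Fin 3) => (y - z) j)
      (EuclideanSpace.proj (𝕜 := ℝ) j) x :=
    (EuclideanSpace.proj (𝕜 := ℝ) j).hasFDerivAt.comp x ((hasFDerivAt_id x).sub_const z)
  refine (hcoord.smul (hasFDerivAt_comp_norm_sub hxz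
    (hasDerivAt_gradientProfile k hr))).congr_of_eventuallyEq ?_
  filter_upwards [isOpen_ne.mem_nhds hxz] with y hy
  rw [fderiv_Gk_single k hy, Pi.smul_apply', Complex.real_smul]

/-- The Hessian in `x` of `G_k(x,z)` exists at `x ≠ z` and equals
`(e^{ikr}/(4π)) [ (1/r³)(3 r̂⊗r̂ − I) − (ik/r²)(3 r̂⊗r̂ − I) − (k²/r) r̂⊗r̂ ]`. -/
theorem hessian_Gk (k : ℝ) (z x : EuclideanSpace ℝ (Fin 3)) (hxz : x ≠ z) :
    (∀ j : Fin 3, DifferentiableAt ℝ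
        (fun y => fderiv ℝ (fun w => Gk k w z) y (EuclideanSpace.single j 1)) x) ∧
    ∀ i j : Fin 3,
      fderiv ℝ (fun y => fderiv ℝ (fun w => Gk k w z) y (EuclideanSpace.single j 1)) x
          (EuclideanSpace.single i 1) =
        Complex.exp (Complex.I * k * ‖x - z‖) / (4 * Real.pi) *
          ((1 / (‖x - z‖ : ℂ) ^ 3) *
              (3 * rhat x z i * rhat x z j - if i = j then 1 else 0)
            - Complex.I * k / (‖x - z‖ : ℂ) ^ 2 *
              (3 * rhat x z i * rhat x z j - if i = j then 1 else 0)
            - (k : ℂ) ^ 2 / (‖x - z‖ : ℂ) * (rhat x z i * rhat x z j)) := by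
  have hr : (‖x - z‖ : ℂ) ≠ 0 := by
    exact_mod_cast norm_ne_zero_iff.mpr (sub_ne_zero.mpr hxz)
  refine ⟨fun j => (hasFDerivAt_fderiv_Gk_single k hxz j).differentiableAt, fun i j => ?_⟩
  rw [(hasFDerivAt_fderiv_Gk_single k hxz j).fderiv]
  by_cases hij : i = j
  · subst hij
    simp [rhat, gradientProfile, EuclideanSpace.inner_single_right]
    field_simp
    ring
  · simp [rhat, gradientProfile, EuclideanSpace.inner_single_right, hij, Ne.symm hij]
    field_simp
end

section
/- Let z ∈ ℝ³, let h, E ∈ ℂ³, and let M be a complex 3×3 matrix with trace zero. Define the vector field F : ℝ³ → ℂ³ by F(x) = (1/2) h × (x − z) + (1/3) (M(x − z)) × (x − z) + E, where the cross products are taken with (x − z) regarded as a vector in ℂ³. Then F is differentiable everywhere and its curl is the affine field (∇ × F)(x) = h + M(x − z) for all x ∈ ℝ³. -/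
/-- The Levi-Civita symbol on three indices. -/
def eps (i j k : Fin 3) : ℤ :=
  if (i, j, k) = (0, 1, 2) ∨ (i, j, k) = (1, 2, 0) ∨ (i, j, k) = (2, 0, 1) then 1
  else if (i, j, k) = (2, 1, 0) ∨ (i, j, k) = (1, 0, 2) ∨ (i, j, k) = (0, 2, 1) then -1
  else 0

/-- The cross product on `ℂ³`: `(a × b)_i = Σ_{j,k} ε_{ijk} a_j b_k`. -/
noncomputable def crossC (a b : Fin 3 → ℂ) : Fin 3 → ℂ :=
  fun i => ∑ j : Fin 3, ∑ k : Fin 3, (eps i j k : ℂ) * a j * b k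

/-- The vector `x − z` viewed in `ℂ³`. -/
noncomputable def vecC (x z : EuclideanSpace ℝ (Fin 3)) : Fin 3 → ℂ :=
  fun i => ((x - z) i : ℂ)

/-- The field `F(x) = (1/2) h × (x − z) + (1/3) (M(x − z)) × (x − z) + E`. -/
noncomputable def Fld (z : EuclideanSpace ℝ (Fin 3)) (h E : Fin 3 → ℂ)
    (M : Matrix (Fin 3) (Fin 3) ℂ) (x : EuclideanSpace ℝ (Fin 3)) : Fin 3 → ℂ :=
  fun i => (1 / 2 : ℂ) * crossC h (vecC x z) i
    + (1 / 3 : ℂ) * crossC (M.mulVec (vecC x z)) (vecC x z) i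
    + E i

/-- The embedding `ℝ³ → ℂ` given by the `i`-th coordinate. -/
noncomputable def coordC (i : Fin 3) : EuclideanSpace ℝ (Fin 3) →L[ℝ] ℂ :=
  Complex.ofRealCLM.comp (EuclideanSpace.proj i)

theorem coordC_single (i j : Fin 3) :
    coordC i (EuclideanSpace.single j 1) = if i = j then 1 else 0 := by
  simp [coordC, apply_ite]

theorem hasFDerivAt_vecC (x z : EuclideanSpace ℝ (Fin 3)) (i : Fin 3) :
    HasFDerivAt (fun y => vecC y z i) (coordC i) x :=
  (coordC i).hasFDerivAt.comp x ((hasFDerivAt_id x).sub_const z)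

theorem hasFDerivAt_mulVec_vecC (M : Matrix (Fin 3) (Fin 3) ℂ)
    (x z : EuclideanSpace ℝ (Fin 3)) (i : Fin 3) :
    HasFDerivAt (fun y => M.mulVec (vecC y z) i) (∑ j, M i j • coordC j) x := by
  simp only [Matrix.mulVec, dotProduct]
  exact HasFDerivAt.fun_sum fun j _ => (hasFDerivAt_vecC x z j).const_mul (M i j)

theorem hasFDerivAt_crossC {V : Type*} [NormedAddCommGroup V] [NormedSpace ℝ V]
    {a b : V → Fin 3 → ℂ} {a' b' : Fin 3 → V →L[ℝ] ℂ} {x : V}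
    (ha : ∀ i, HasFDerivAt (fun y => a y i) (a' i) x)
    (hb : ∀ i, HasFDerivAt (fun y => b y i) (b' i) x) (i : Fin 3) :
    HasFDerivAt (fun y => crossC (a y) (b y) i)
      (∑ j, ∑ k, (((eps i j k : ℂ) * a x j) • b' k + b x k • (eps i j k : ℂ) • a' j)) x :=
  HasFDerivAt.fun_sum fun j _ => HasFDerivAt.fun_sum fun k _ =>
    ((ha j).const_mul (eps i j k : ℂ)).mul (hb k)

theorem hasFDerivAt_Fld (z : EuclideanSpace ℝ (Fin 3)) (h E : Fin 3 → ℂ)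
    (M : Matrix (Fin 3) (Fin 3) ℂ) (x : EuclideanSpace ℝ (Fin 3)) (i : Fin 3) :
    HasFDerivAt (fun y => Fld z h E M y i)
      ((1 / 2 : ℂ) • (∑ j, ∑ k, (((eps i j k : ℂ) * h j) • coordC k
          + vecC x z k • (eps i j k : ℂ) • (0 : EuclideanSpace ℝ (Fin 3) →L[ℝ] ℂ)))
        + (1 / 3 : ℂ) • (∑ j, ∑ k, (((eps i j k : ℂ) * M.mulVec (vecC x z) j) • coordC k
          + vecC x z k • (eps i j k : ℂ) • ∑ l, M j l • coordC l))) x :=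
  (((hasFDerivAt_crossC (fun j => hasFDerivAt_const (h j) x)
      (hasFDerivAt_vecC x z) i).const_mul (1 / 2 : ℂ)).add
    ((hasFDerivAt_crossC (hasFDerivAt_mulVec_vecC M x z)
      (hasFDerivAt_vecC x z) i).const_mul (1 / 3 : ℂ))).add_const (E i)

/-- If `M` has trace zero, then `F` is differentiable everywhere and
`(∇ × F)(x) = h + M(x − z)` for all `x`. -/
theorem curl_Fld (z : EuclideanSpace ℝ (Fin 3)) (h E : Fin 3 → ℂ)
    (M : Matrix (Fin 3) (Fin 3) ℂ) (hM : Matrix.trace M = 0) :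
    (∀ i : Fin 3, Differentiable ℝ (fun x => Fld z h E M x i)) ∧
    ∀ x : EuclideanSpace ℝ (Fin 3), ∀ i : Fin 3,
      (∑ j : Fin 3, ∑ l : Fin 3, (eps i j l : ℂ) *
          fderiv ℝ (fun y => Fld z h E M y l) x (EuclideanSpace.single j 1)) =
        h i + M.mulVec (vecC x z) i := by
  refine ⟨fun i x => (hasFDerivAt_Fld z h E M x i).differentiableAt, fun x i => ?_⟩
  simp only [(hasFDerivAt_Fld z h E M x _).fderiv]
  have hM' : M 2 2 = -M 0 0 - M 1 1 := by
    rw [Matrix.trace_fin_three] at hM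
    linear_combination hM
  generalize vecC x z = w
  fin_cases i <;>
  · simp [Fin.sum_univ_three, eps, coordC_single, Matrix.mulVec, dotProduct, hM']
    ring
end
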